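/- Let k≥1 be an integer, R>1, let ν be a compactly supported Borel probability measure on P_k with ‖q‖_2 ≤ R for all q∈supp(ν), and let θ be a compactly supported Borel probability measure on I=[0,1]. Then there is a constant K=K(k,R)>0 such that for every n≥m≥1: (1/n)H(ν.θ, D_n) ≥ E_{1≤i≤n}( (1/m)H(ν_{q,i}.θ_{x,i}, D_{i+m}) ) − K(1/m + m/n), where the expectation is over i uniform in {1,…,n} and (q,x) distributed according to ν×θ. -/

import Mathlib

open MeasureTheory Filter Set Metric Topology

noncomputable section

/-- The unit interval `I = [0,1]`. -/
def unitI : Set ℝ := Set.Icc 0 1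

/-- The level-`n` dyadic interval `[m/2^n, (m+1)/2^n)`. -/
def dyadIco (n : ℕ) (m : ℤ) : Set ℝ :=
  Set.Ico ((m : ℝ) / 2 ^ n) (((m : ℝ) + 1) / 2 ^ n)

/-- Entropy of a measure on `ℝ` with respect to the level-`n` dyadic partition
(logarithms in base 2). -/
def ent1 (n : ℕ) (θ : Measure ℝ) : ℝ :=
  -∑' m : ℤ, (θ (dyadIco n m)).toReal * Real.logb 2 (θ (dyadIco n m)).toReal

/-- The level-`n` dyadic cell containing `x`. -/
def dcell (n : ℕ) (x : ℝ) : Set ℝ := dyadIco n ⌊x * 2 ^ n⌋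

/-- The level-`n` component `θ_{x,n}`: `θ` conditioned on the dyadic cell of `x`. -/
def dcomp (θ : Measure ℝ) (x : ℝ) (n : ℕ) : Measure ℝ :=
  (θ (dcell n x))⁻¹ • θ.restrict (dcell n x)

/-- The space `P_k` of polynomials of degree at most `k`, identified with `ℝ^{k+1}`
via coefficients; `polyEval k a` is the corresponding polynomial function. -/
def polyEval (k : ℕ) (a : EuclideanSpace ℝ (Fin (k + 1))) (x : ℝ) : ℝ :=
  ∑ j : Fin (k + 1), a j * x ^ (j : ℕ)

/-- The level-`n` dyadic cell of `ℝ^d` indexed by `m : Fin d → ℤ`. -/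
def vcell (d n : ℕ) (m : Fin d → ℤ) : Set (EuclideanSpace ℝ (Fin d)) :=
  {x | ∀ j, x j ∈ Set.Ico ((m j : ℝ) / 2 ^ n) (((m j : ℝ) + 1) / 2 ^ n)}

/-- Entropy of a measure on `ℝ^d ≃ P_{d-1}` with respect to the level-`n` dyadic
partition (logarithms in base 2). -/
def entV (d n : ℕ) (θ : Measure (EuclideanSpace ℝ (Fin d))) : ℝ :=
  -∑' m : Fin d → ℤ,
    (θ (vcell d n m)).toReal * Real.logb 2 (θ (vcell d n m)).toReal

/-- The level-`n` component `ν_{q,n}` of a measure on `ℝ^d`. -/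
def vcomp {d : ℕ} (ν : Measure (EuclideanSpace ℝ (Fin d)))
    (q : EuclideanSpace ℝ (Fin d)) (n : ℕ) : Measure (EuclideanSpace ℝ (Fin d)) :=
  (ν (vcell d n fun j => ⌊q j * 2 ^ n⌋))⁻¹ • ν.restrict (vcell d n fun j => ⌊q j * 2 ^ n⌋)

/-- The topological support of a measure. -/
def msupp {X : Type*} [TopologicalSpace X] [MeasurableSpace X] (θ : Measure X) : Set X :=
  {x | ∀ U : Set X, IsOpen U → x ∈ U → θ U ≠ 0}

/-- The measure `ν.θ`: the pushforward of `ν × θ` under `(q, x) ↦ q(x)`. -/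
def pact (k : ℕ) (ν : Measure (EuclideanSpace ℝ (Fin (k + 1)))) (θ : Measure ℝ) :
    Measure ℝ :=
  (ν.prod θ).map fun q => polyEval k q.1 q.2

/-- Gibbs' inequality for a single term. -/
lemma negMulLog_add_mul_log_le {a r : ℝ} (ha : 0 ≤ a) (hr : 0 ≤ r) (h : r = 0 → a = 0) :
    Real.negMulLog a + a * Real.log r ≤ r - a := by
  rcases ha.eq_or_lt with rfl | ha
  · simpa using hr
  have hr : 0 < r := hr.lt_of_ne fun h0 => ha.ne' (h h0.symm)
  have key := Real.log_le_sub_one_of_pos (div_pos hr ha)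
  rw [Real.log_div hr.ne' ha.ne'] at key
  have := mul_le_mul_of_nonneg_left key ha.le
  rw [mul_sub, mul_sub, mul_div_cancel₀ _ ha.ne', mul_one] at this
  rw [Real.negMulLog]
  linarith

lemma mem_dyadIco {n : ℕ} {J : ℤ} {x : ℝ} : x ∈ dyadIco n J ↔ ⌊x * 2 ^ n⌋ = J := by
  rw [dyadIco, mem_Ico, Int.floor_eq_iff, div_le_iff₀ (by positivity), lt_div_iff₀ (by positivity)]

lemma measurable_floor_mul (n : ℕ) : Measurable fun x : ℝ => ⌊x * 2 ^ n⌋ :=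
  (measurable_id.mul_const _).floor

lemma measurableSet_dyadIco (n : ℕ) (J : ℤ) : MeasurableSet (dyadIco n J) := measurableSet_Ico

lemma floor_mul_ediv (n m : ℕ) (x : ℝ) : ⌊x * 2 ^ (n + m)⌋ / (2 ^ m : ℤ) = ⌊x * 2 ^ n⌋ := by
  have h := Int.floor_div_natCast (x * 2 ^ (n + m)) (2 ^ m)
  push_cast at h
  rw [← h, pow_add, ← mul_assoc, mul_div_cancel_right₀ _ (by positivity)]

/-- The indices of the level-`n` dyadic intervals contained in `[-M, M)`. -/
def dyadIdx (M n : ℕ) : Finset ℤ := Finset.Ico (-(M * 2 ^ n)) (M * 2 ^ n)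

lemma floor_mem_dyadIdx {M : ℕ} (n : ℕ) {x : ℝ} (hx : x ∈ Ico (-M : ℝ) M) :
    ⌊x * 2 ^ n⌋ ∈ dyadIdx M n := by
  rw [dyadIdx, Finset.mem_Ico, Int.le_floor, Int.floor_lt]
  push_cast
  rw [← neg_mul]
  exact ⟨by gcongr; exact hx.1, by gcongr; exact hx.2⟩

lemma ediv_mem_dyadIdx {M n m : ℕ} {J : ℤ} (hJ : J ∈ dyadIdx M (n + m)) :
    J / 2 ^ m ∈ dyadIdx M n := by
  rw [dyadIdx, Finset.mem_Ico] at *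
  rw [Int.le_ediv_iff_mul_le (by positivity), Int.ediv_lt_iff_lt_mul (by positivity),
    neg_mul, mul_assoc, ← pow_add]
  exact hJ

lemma measure_dyadIco_eq_zero {M n : ℕ} {μ : Measure ℝ} (hμ : ∀ᵐ y ∂μ, y ∈ Ico (-M : ℝ) M)
    {J : ℤ} (hJ : J ∉ dyadIdx M n) : μ (dyadIco n J) = 0 := by
  refine measure_mono_null ?_ (ae_iff.1 hμ)
  intro y hy hy'
  refine hJ ?_
  rw [← mem_dyadIco.1 hy]
  exact floor_mem_dyadIdx n hy'

/-- Entropy as a finite sum, for measures concentrated on a bounded interval. -/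
lemma ent1_eq_sum {M : ℕ} (n : ℕ) {μ : Measure ℝ} (hμ : ∀ᵐ y ∂μ, y ∈ Ico (-M : ℝ) M) :
    ent1 n μ = (∑ J ∈ dyadIdx M n, Real.negMulLog (μ.real (dyadIco n J))) / Real.log 2 := by
  rw [ent1, tsum_eq_sum (s := dyadIdx M n)]
  · rw [← Finset.sum_neg_distrib, Finset.sum_div]
    refine Finset.sum_congr rfl fun J _ => ?_
    simp only [Real.negMulLog, Real.logb, Measure.real]
    ring
  · intro J hJ
    simp [measure_dyadIco_eq_zero hμ hJ]

/-- A finite measure of a set as a sum over the values of a map with essentially finite range. -/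
lemma measureReal_eq_sum_inter_preimage {Z ι : Type*} [MeasurableSpace Z] [MeasurableSpace ι]
    [MeasurableSingletonClass ι] (μ : Measure Z) [IsFiniteMeasure μ] {f : Z → ι}
    (hf : Measurable f) {S : Finset ι} (hS : ∀ᵐ z ∂μ, f z ∈ S) (E : Set Z) :
    μ.real E = ∑ c ∈ S, μ.real (E ∩ f ⁻¹' {c}) := by
  have h := sum_measureReal_preimage_singleton (μ := μ.restrict E) S (f := f)
    fun c _ => hf (measurableSet_singleton c)
  have h2 : (μ.restrict E).real (f ⁻¹' ↑S) = μ.real E := by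
    rw [measureReal_congr (s := f ⁻¹' ↑S) (t := univ) (ae_eq_univ.2 (ae_restrict_of_ae hS)),
      measureReal_restrict_apply_univ]
  rw [← h2, ← h]
  refine Finset.sum_congr rfl fun c _ => ?_
  rw [measureReal_restrict_apply (hf (measurableSet_singleton c)), inter_comm]

lemma sum_measureReal_dyadIco {M : ℕ} (n : ℕ) {μ : Measure ℝ} [IsFiniteMeasure μ]
    (hμ : ∀ᵐ y ∂μ, y ∈ Ico (-M : ℝ) M) :
    ∑ J ∈ dyadIdx M n, μ.real (dyadIco n J) = μ.real univ := by
  rw [measureReal_eq_sum_inter_preimage μ (measurable_floor_mul n)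
    (hμ.mono fun y hy => floor_mem_dyadIdx n hy) univ]
  refine Finset.sum_congr rfl fun J _ => congrArg _ ?_
  ext x
  simp [mem_dyadIco]

lemma measureReal_dyadIco_eq_sum {M : ℕ} (n m : ℕ) {μ : Measure ℝ} [IsFiniteMeasure μ]
    (hμ : ∀ᵐ y ∂μ, y ∈ Ico (-M : ℝ) M) (I : ℤ) :
    μ.real (dyadIco n I) =
      ∑ J ∈ dyadIdx M (n + m) with J / 2 ^ m = I, μ.real (dyadIco (n + m) J) := by
  rw [measureReal_eq_sum_inter_preimage μ (measurable_floor_mul (n + m))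
    (hμ.mono fun y hy => floor_mem_dyadIdx (n + m) hy), Finset.sum_filter]
  refine Finset.sum_congr rfl fun J _ => ?_
  split_ifs with h
  · refine congrArg _ ?_
    ext x
    simp only [mem_inter_iff, mem_dyadIco, mem_preimage, mem_singleton_iff, and_iff_right_iff_imp]
    rintro rfl
    rw [← h, floor_mul_ediv]
  · rw [show dyadIco n I ∩ (fun x : ℝ => ⌊x * 2 ^ (n + m)⌋) ⁻¹' {J} = ∅ from ?_, measureReal_empty]
    refine eq_empty_of_forall_notMem fun x ⟨hx, hJ⟩ => h ?_
    rw [← mem_dyadIco.1 hx, ← floor_mul_ediv n m, ← show _ = J from hJ]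

lemma dyadIco_subset (n m : ℕ) (J : ℤ) : dyadIco (n + m) J ⊆ dyadIco n (J / 2 ^ m) := by
  intro x hx
  rw [mem_dyadIco, ← floor_mul_ediv n m, mem_dyadIco.1 hx]

/-- Summing a function of the coarse cell against the masses of the fine cells. -/
lemma sum_measureReal_dyadIco_mul {M : ℕ} (n m : ℕ) {μ : Measure ℝ} [IsFiniteMeasure μ]
    (hμ : ∀ᵐ y ∂μ, y ∈ Ico (-M : ℝ) M) (f : ℤ → ℝ) :
    ∑ J ∈ dyadIdx M (n + m), μ.real (dyadIco (n + m) J) * f (J / 2 ^ m) =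
      ∑ I ∈ dyadIdx M n, μ.real (dyadIco n I) * f I := by
  rw [← Finset.sum_fiberwise_of_maps_to fun J hJ => ediv_mem_dyadIdx (n := n) (m := m) hJ]
  refine Finset.sum_congr rfl fun I _ => ?_
  rw [measureReal_dyadIco_eq_sum n m hμ I, Finset.sum_mul]
  refine Finset.sum_congr rfl fun J hJ => ?_
  rw [(Finset.mem_filter.1 hJ).2]

lemma ent1_nonneg (n : ℕ) (μ : Measure ℝ) [IsProbabilityMeasure μ] : 0 ≤ ent1 n μ := by
  rw [ent1, ← tsum_neg]
  refine tsum_nonneg fun J => ?_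
  have := div_nonneg (Real.negMulLog_nonneg (x := μ.real (dyadIco n J)) measureReal_nonneg
    measureReal_le_one) (Real.log_nonneg one_le_two)
  simp only [Real.negMulLog, Measure.real] at this
  rw [Real.logb]
  convert this using 1
  ring

/-- Refining the dyadic partition by `m` levels increases entropy by at most `m`. -/
lemma ent1_add_le {M : ℕ} (n m : ℕ) {μ : Measure ℝ} [IsProbabilityMeasure μ]
    (hμ : ∀ᵐ y ∂μ, y ∈ Ico (-M : ℝ) M) : ent1 (n + m) μ ≤ ent1 n μ + m := by
  have h2 : (0 : ℝ) < Real.log 2 := Real.log_pos one_lt_two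
  rw [ent1_eq_sum _ hμ, ent1_eq_sum _ hμ, ← sub_le_iff_le_add', ← sub_div, div_le_iff₀ h2]
  set b : ℤ → ℝ := fun I => μ.real (dyadIco n I)
  set a : ℤ → ℝ := fun J => μ.real (dyadIco (n + m) J)
  have hab : ∀ J, a J ≤ b (J / 2 ^ m) := fun J => measureReal_mono (dyadIco_subset n m J)
  have hsum : ∑ J ∈ dyadIdx M (n + m), a J = 1 := by simp [a, sum_measureReal_dyadIco _ hμ]
  have hsumb : ∑ I ∈ dyadIdx M n, b I = 1 := by simp [b, sum_measureReal_dyadIco _ hμ]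
  have key : ∀ J, Real.negMulLog (a J) + a J * (Real.log (b (J / 2 ^ m)) - m * Real.log 2) ≤
      b (J / 2 ^ m) / 2 ^ m - a J := by
    intro J
    have hb0 : 0 ≤ b (J / 2 ^ m) := measureReal_nonneg
    rcases hb0.eq_or_lt with h0 | h0
    · have : a J = 0 := le_antisymm (h0 ▸ hab J) measureReal_nonneg
      rw [this, ← h0]; simp
    · have := negMulLog_add_mul_log_le (a := a J) (r := b (J / 2 ^ m) / 2 ^ m) measureReal_nonneg
        (by positivity) fun h => absurd h (by positivity)
      rwa [Real.log_div h0.ne' (by positivity), Real.log_pow] at this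
  have hfib : ∑ J ∈ dyadIdx M (n + m), b (J / 2 ^ m) / 2 ^ m ≤ 1 := by
    rw [← hsumb, ← Finset.sum_fiberwise_of_maps_to
      fun J hJ => ediv_mem_dyadIdx (n := n) (m := m) hJ]
    refine Finset.sum_le_sum fun I _ => ?_
    have hcard : ((dyadIdx M (n + m)).filter fun J => J / 2 ^ m = I).card ≤ 2 ^ m := by
      refine (Finset.card_le_card (t := Finset.Ico (I * 2 ^ m) (I * 2 ^ m + 2 ^ m)) ?_).trans ?_
      · intro J hJ
        have h := (Finset.mem_filter.1 hJ).2
        have hp : (0 : ℤ) < 2 ^ m := by positivity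
        rw [Finset.mem_Ico]
        rw [← h]
        have := Int.emod_add_mul_ediv J (2 ^ m)
        have h1 := Int.emod_nonneg J hp.ne'
        have h2 := Int.emod_lt_of_pos J hp
        constructor <;> linarith
      · rw [Int.card_Ico, add_sub_cancel_left]
        exact_mod_cast le_rfl
    calc _ = ∑ J ∈ dyadIdx M (n + m) with J / 2 ^ m = I, b I / 2 ^ m :=
          Finset.sum_congr rfl fun J hJ => by rw [(Finset.mem_filter.1 hJ).2]
      _ = (((dyadIdx M (n + m)).filter fun J => J / 2 ^ m = I).card / 2 ^ m) * b I := by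
          rw [Finset.sum_const, nsmul_eq_mul]; ring
      _ ≤ 1 * b I := by
          refine mul_le_mul_of_nonneg_right ?_ measureReal_nonneg
          rw [div_le_one (by positivity)]
          exact_mod_cast hcard
      _ = b I := one_mul _
  have tot := Finset.sum_le_sum fun J (_ : J ∈ dyadIdx M (n + m)) => key J
  have hchain := sum_measureReal_dyadIco_mul n m hμ fun I => Real.log (b I)
  simp only [mul_sub, Finset.sum_add_distrib, Finset.sum_sub_distrib, ← Finset.sum_mul, hsum]
    at tot
  have hb : ∑ I ∈ dyadIdx M n, Real.negMulLog (b I) =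
      -∑ I ∈ dyadIdx M n, b I * Real.log (b I) := by
    simp [Real.negMulLog]
  change ∑ J ∈ dyadIdx M (n + m), a J * Real.log (b (J / 2 ^ m)) =
    ∑ I ∈ dyadIdx M n, b I * Real.log (b I) at hchain
  linarith

/-- Concavity of the conditional entropy `H(·, D_{n+m} | D_n)`. -/
lemma sum_mul_ent1_sub_le {ι : Type*} (F : Finset ι) (p : ι → ℝ) (hp : ∀ c, 0 ≤ p c)
    (μ : Measure ℝ) [IsFiniteMeasure μ] (μc : ι → Measure ℝ) [∀ c, IsFiniteMeasure (μc c)]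
    {M : ℕ} (hμ : ∀ᵐ y ∂μ, y ∈ Ico (-M : ℝ) M) (hμc : ∀ c, ∀ᵐ y ∂(μc c), y ∈ Ico (-M : ℝ) M)
    (n m : ℕ)
    (hmix : ∀ l J, μ.real (dyadIco l J) = ∑ c ∈ F, p c * (μc c).real (dyadIco l J)) :
    ∑ c ∈ F, p c * (ent1 (n + m) (μc c) - ent1 n (μc c)) ≤ ent1 (n + m) μ - ent1 n μ := by
  have h2 : (0 : ℝ) < Real.log 2 := Real.log_pos one_lt_two
  simp only [ent1_eq_sum _ hμ, ent1_eq_sum _ (hμc _), ← sub_div, ← mul_div_assoc, ← Finset.sum_div]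
  refine div_le_div_of_nonneg_right ?_ h2.le
  set B : ℤ → ℝ := fun I => μ.real (dyadIco n I) with hB
  set A : ℤ → ℝ := fun J => μ.real (dyadIco (n + m) J) with hA
  set b : ι → ℤ → ℝ := fun c I => (μc c).real (dyadIco n I) with hb
  set a : ι → ℤ → ℝ := fun c J => (μc c).real (dyadIco (n + m) J)
  have hB0 : ∀ I, 0 ≤ B I := fun I => measureReal_nonneg
  have hA0 : ∀ J, 0 ≤ A J := fun I => measureReal_nonneg
  have hb0 : ∀ c I, 0 ≤ b c I := fun c I => measureReal_nonneg
  have ha0 : ∀ c I, 0 ≤ a c I := fun c I => measureReal_nonneg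
  have hAB : ∀ J, A J ≤ B (J / 2 ^ m) := fun J => measureReal_mono (dyadIco_subset n m J)
  have hab : ∀ c J, a c J ≤ b c (J / 2 ^ m) := fun c J => measureReal_mono (dyadIco_subset n m J)
  have hmixA : ∀ J, A J = ∑ c ∈ F, p c * a c J := hmix (n + m)
  have hmixB : ∀ J, B J = ∑ c ∈ F, p c * b c J := hmix n
  have key : ∀ J, ∀ c ∈ F, p c * (Real.negMulLog (a c J) + a c J * (Real.log (b c (J / 2 ^ m)) +
      Real.log (A J) - Real.log (B (J / 2 ^ m)))) ≤
      p c * b c (J / 2 ^ m) * (A J / B (J / 2 ^ m)) - p c * a c J := by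
    intro J c hc
    rw [mul_assoc, ← mul_sub]
    rcases (hp c).eq_or_lt with hpc | hpc
    · simp [← hpc]
    refine mul_le_mul_of_nonneg_left ?_ hpc.le
    rcases (ha0 c J).eq_or_lt with h0 | h0
    · rw [← h0]
      have := mul_nonneg (hb0 c (J / 2 ^ m)) (div_nonneg (hA0 J) (hB0 (J / 2 ^ m)))
      simpa using this
    have hApos : 0 < A J := by
      rw [hmixA]
      exact (mul_pos hpc h0).trans_le (Finset.single_le_sum (f := fun c => p c * a c J)
        (fun d _ => mul_nonneg (hp d) (ha0 d J)) hc)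
    have hBpos := hApos.trans_le (hAB J)
    have hbpos := h0.trans_le (hab c J)
    have hpos := mul_pos hbpos (div_pos hApos hBpos)
    have := negMulLog_add_mul_log_le (ha0 c J) hpos.le fun h => absurd h hpos.ne'
    rw [Real.log_mul hbpos.ne' (div_pos hApos hBpos).ne', Real.log_div hApos.ne' hBpos.ne'] at this
    rwa [add_sub_assoc]
  have keyJ : ∀ J, ∑ c ∈ F, p c * (Real.negMulLog (a c J) +
      a c J * Real.log (b c (J / 2 ^ m))) ≤
      Real.negMulLog (A J) + A J * Real.log (B (J / 2 ^ m)) := by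
    intro J
    have h := Finset.sum_le_sum (key J)
    rw [Finset.sum_sub_distrib, ← Finset.sum_mul, ← hmixA, ← hmixB] at h
    have h3 : B (J / 2 ^ m) * (A J / B (J / 2 ^ m)) = A J := by
      rcases (hB0 (J / 2 ^ m)).eq_or_lt with h0 | h0
      · rw [← h0, le_antisymm (h0 ▸ hAB J) (hA0 J)]; simp
      · exact mul_div_cancel₀ _ h0.ne'
    rw [h3, sub_self] at h
    have h4 : ∑ c ∈ F, p c * (Real.negMulLog (a c J) + a c J * (Real.log (b c (J / 2 ^ m)) +
        Real.log (A J) - Real.log (B (J / 2 ^ m)))) =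
        ∑ c ∈ F, p c * (Real.negMulLog (a c J) + a c J * Real.log (b c (J / 2 ^ m))) +
          A J * (Real.log (A J) - Real.log (B (J / 2 ^ m))) := by
      have h5 := congrArg (· * (Real.log (A J) - Real.log (B (J / 2 ^ m)))) (hmixA J)
      rw [show A J * (Real.log (A J) - Real.log (B (J / 2 ^ m))) = _ from h5]
      rw [Finset.sum_mul, ← Finset.sum_add_distrib]
      exact Finset.sum_congr rfl fun c _ => by ring
    rw [h4] at h
    rw [Real.negMulLog]
    linarith
  have tot := Finset.sum_le_sum fun J (_ : J ∈ dyadIdx M (n + m)) => keyJ J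
  rw [Finset.sum_comm, Finset.sum_add_distrib,
    sum_measureReal_dyadIco_mul n m hμ fun I => Real.log (B I)] at tot
  have hc : ∀ c, ∑ J ∈ dyadIdx M (n + m),
      p c * (Real.negMulLog (a c J) + a c J * Real.log (b c (J / 2 ^ m))) =
      p c * (∑ J ∈ dyadIdx M (n + m), Real.negMulLog (a c J) -
        ∑ I ∈ dyadIdx M n, Real.negMulLog (b c I)) := by
    intro c
    rw [← Finset.mul_sum, Finset.sum_add_distrib,
      sum_measureReal_dyadIco_mul n m (hμc c) fun I => Real.log (b c I)]
    simp [Real.negMulLog, hb]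
  simp only [hc] at tot
  refine tot.trans (le_of_eq ?_)
  simp [Real.negMulLog, hB, hA]

/-- The entropy at scale `2⁻ⁿ` of a measure concentrated on an interval of length `O(2⁻ⁿ)`. -/
lemma ent1_le_logb_of_ae_near {M : ℕ} (n L : ℕ) {μ : Measure ℝ} [IsProbabilityMeasure μ]
    (hμ : ∀ᵐ y ∂μ, y ∈ Ico (-M : ℝ) M) (y₀ : ℝ) (h : ∀ᵐ y ∂μ, |y - y₀| ≤ L / 2 ^ n) :
    ent1 n μ ≤ Real.logb 2 (2 * L + 3) := by
  have h2 : (0 : ℝ) < Real.log 2 := Real.log_pos one_lt_two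
  rw [ent1_eq_sum n hμ, Real.logb]
  refine div_le_div_of_nonneg_right ?_ h2.le
  set b : ℤ → ℝ := fun I => μ.real (dyadIco n I)
  set W : Finset ℤ := Finset.Icc (⌊y₀ * 2 ^ n⌋ - (L + 1)) (⌊y₀ * 2 ^ n⌋ + (L + 1))
  have hcard : (W.card : ℝ) = 2 * L + 3 := by
    have : (W.card : ℤ) = 2 * L + 3 := by rw [Int.card_Icc]; omega
    exact_mod_cast this
  have hW : ∀ I ∉ W, b I = 0 := by
    intro I hI
    refine (measureReal_eq_zero_iff (by finiteness)).2 (measure_mono_null ?_ (ae_iff.1 h))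
    intro y hy hy'
    refine hI ?_
    rw [mem_dyadIco] at hy
    have h' : |y * 2 ^ n - y₀ * 2 ^ n| ≤ L := by
      rw [← sub_mul, abs_mul, abs_of_pos (by positivity : (0 : ℝ) < 2 ^ n)]
      exact (le_div_iff₀ (by positivity)).1 hy'
    rw [abs_le] at h'
    rw [Finset.mem_Icc, ← hy]
    have := Int.floor_le (y * 2 ^ n)
    have := Int.lt_floor_add_one (y * 2 ^ n)
    have := Int.floor_le (y₀ * 2 ^ n)
    have := Int.lt_floor_add_one (y₀ * 2 ^ n)
    constructor
    · have : ((⌊y₀ * 2 ^ n⌋ : ℤ) : ℝ) - (L + 1) ≤ ⌊y * 2 ^ n⌋ := by linarith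
      exact_mod_cast this
    · have : ((⌊y * 2 ^ n⌋ : ℤ) : ℝ) ≤ ⌊y₀ * 2 ^ n⌋ + (L + 1) := by linarith
      exact_mod_cast this
  have hT : ∀ I ∉ dyadIdx M n, b I = 0 := fun I hI => by
    simp [b, Measure.real, measure_dyadIco_eq_zero hμ hI]
  have hrestr : ∀ f : ℝ → ℝ, f 0 = 0 → ∑ I ∈ dyadIdx M n, f (b I) = ∑ I ∈ W, f (b I) := by
    intro f hf
    exact (Finset.sum_subset (Finset.subset_union_left (s₂ := W))
      fun I _ hI => by rw [hT I hI, hf]).trans (Finset.sum_subset Finset.subset_union_right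
        fun I _ hI => by rw [hW I hI, hf]).symm
  have hsum : ∑ I ∈ W, b I = 1 := by
    refine (hrestr id rfl).symm.trans ?_
    simp [b, sum_measureReal_dyadIco _ hμ]
  rw [hrestr _ Real.negMulLog_zero]
  have hpos : (0 : ℝ) < 2 * L + 3 := by positivity
  have tot := Finset.sum_le_sum fun I (_ : I ∈ W) =>
    negMulLog_add_mul_log_le (a := b I) (r := (2 * L + 3)⁻¹) measureReal_nonneg
      (by positivity) fun h => absurd h (by positivity)
  rw [Finset.sum_add_distrib, ← Finset.sum_mul, Finset.sum_sub_distrib, hsum, Finset.sum_const,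
    nsmul_eq_mul, hcard, mul_inv_cancel₀ hpos.ne', Real.log_inv] at tot
  linarith

lemma mem_vcell {d n : ℕ} {u : Fin d → ℤ} {q : EuclideanSpace ℝ (Fin d)} :
    q ∈ vcell d n u ↔ (fun j => ⌊q j * 2 ^ n⌋) = u := by
  rw [funext_iff]
  exact forall_congr' fun j => mem_dyadIco

lemma measurable_floor_mul_apply {d : ℕ} (n : ℕ) :
    Measurable fun (q : EuclideanSpace ℝ (Fin d)) (j : Fin d) => ⌊q j * 2 ^ n⌋ :=
  measurable_pi_lambda _ fun j => (measurable_floor_mul n).comp (by fun_prop)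

lemma abs_apply_le_norm {d : ℕ} (q : EuclideanSpace ℝ (Fin d)) (j : Fin d) : |q j| ≤ ‖q‖ :=
  PiLp.norm_apply_le q j

lemma continuous_polyEval (k : ℕ) :
    Continuous fun z : EuclideanSpace ℝ (Fin (k + 1)) × ℝ => polyEval k z.1 z.2 := by
  unfold polyEval
  fun_prop

lemma abs_polyEval_le {k : ℕ} {R : ℝ} {q : EuclideanSpace ℝ (Fin (k + 1))} (hq : ‖q‖ ≤ R)
    {x : ℝ} (hx : x ∈ Icc (0 : ℝ) 1) : |polyEval k q x| ≤ (k + 1) * R := by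
  have h : ∀ j : Fin (k + 1), |q j * x ^ (j : ℕ)| ≤ R := fun j => by
    rw [abs_mul, abs_of_nonneg (pow_nonneg hx.1 _)]
    exact (mul_le_of_le_one_right (abs_nonneg _) (pow_le_one₀ hx.1 hx.2)).trans
      ((abs_apply_le_norm q j).trans hq)
  refine (Finset.abs_sum_le_sum_abs _ _).trans ((Finset.sum_le_sum fun j _ => h j).trans ?_)
  simp

lemma abs_polyEval_sub_le {k : ℕ} {R δ : ℝ} {q q' : EuclideanSpace ℝ (Fin (k + 1))}
    (hq' : ‖q'‖ ≤ R) {x x' : ℝ} (hx : x ∈ Icc (0 : ℝ) 1) (hx' : x' ∈ Icc (0 : ℝ) 1)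
    (hqq : ∀ j, |q j - q' j| ≤ δ) (hxx : |x - x'| ≤ δ) :
    |polyEval k q x - polyEval k q' x'| ≤ (k + 1) * (1 + R * k) * δ := by
  have hR : 0 ≤ R := (norm_nonneg _).trans hq'
  have h : ∀ j : Fin (k + 1), |q j * x ^ (j : ℕ) - q' j * x' ^ (j : ℕ)| ≤ (1 + R * k) * δ := by
    intro j
    have hpow : |x ^ (j : ℕ) - x' ^ (j : ℕ)| ≤ δ * k := by
      have hjk : ((j : ℕ) : ℝ) ≤ k := by exact_mod_cast Nat.lt_succ_iff.1 j.2
      have hmax : max |x| |x'| ≤ 1 :=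
        max_le ((abs_of_nonneg hx.1).trans_le hx.2) ((abs_of_nonneg hx'.1).trans_le hx'.2)
      calc |x ^ (j : ℕ) - x' ^ (j : ℕ)| ≤ |x - x'| * (j : ℕ) * max |x| |x'| ^ ((j : ℕ) - 1) :=
            abs_pow_sub_pow_le _ _ _
        _ ≤ |x - x'| * (j : ℕ) :=
            mul_le_of_le_one_right (by positivity) (pow_le_one₀ (by positivity) hmax)
        _ ≤ δ * k := mul_le_mul hxx hjk (by positivity) ((abs_nonneg _).trans hxx)
    calc |q j * x ^ (j : ℕ) - q' j * x' ^ (j : ℕ)|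
        = |(q j - q' j) * x ^ (j : ℕ) + q' j * (x ^ (j : ℕ) - x' ^ (j : ℕ))| := by
          congr 1; ring
      _ ≤ |q j - q' j| * |x ^ (j : ℕ)| + |q' j| * |x ^ (j : ℕ) - x' ^ (j : ℕ)| := by
          rw [← abs_mul, ← abs_mul]
          exact abs_add_le _ _
      _ ≤ δ * 1 + R * (δ * k) := by
          gcongr
          · exact (abs_nonneg _).trans (hqq j)
          · exact hqq j
          · rw [abs_of_nonneg (pow_nonneg hx.1 _)]
            exact pow_le_one₀ hx.1 hx.2
          · exact (abs_apply_le_norm q' j).trans hq'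
      _ = (1 + R * k) * δ := by ring
  rw [polyEval, polyEval, ← Finset.sum_sub_distrib]
  refine (Finset.abs_sum_le_sum_abs _ _).trans ((Finset.sum_le_sum fun j _ => h j).trans ?_)
  rw [Finset.sum_const, Finset.card_univ, Fintype.card_fin, nsmul_eq_mul]
  push_cast
  rw [mul_assoc]

lemma abs_sub_le_of_mem_dyadIco {n : ℕ} {J : ℤ} {x y : ℝ} (hx : x ∈ dyadIco n J)
    (hy : y ∈ dyadIco n J) : |x - y| ≤ 1 / 2 ^ n := by
  have h1 : ((J : ℝ) + 1) / 2 ^ n = J / 2 ^ n + 1 / 2 ^ n := add_div _ _ _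
  rw [dyadIco, mem_Ico, h1] at hx hy
  rw [abs_le]
  constructor <;> linarith [hx.1, hx.2, hy.1, hy.2]

lemma restrict_eq_smul_cond {X : Type*} [MeasurableSpace X] (μ : Measure X) [IsFiniteMeasure μ]
    (s : Set X) : μ.restrict s = μ s • ProbabilityTheory.cond μ s := by
  rw [ProbabilityTheory.cond, smul_smul]
  by_cases h : μ s = 0
  · simp [h]
  · rw [ENNReal.mul_inv_cancel h (by finiteness), one_smul]

lemma ae_norm_le_of_msupp {d : ℕ} {R : ℝ} {ν : Measure (EuclideanSpace ℝ (Fin d))}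
    (h : ∀ q ∈ msupp ν, ‖q‖ ≤ R) : ∀ᵐ q ∂ν, ‖q‖ ≤ R := by
  refine measure_null_of_locally_null _ fun q hq => ?_
  have hq' : q ∉ msupp ν := fun hm => hq (h q hm)
  simp only [msupp, mem_ofPred_eq, not_forall, not_not] at hq'
  obtain ⟨U, hU, hqU, h0⟩ := hq'
  exact ⟨U, mem_nhdsWithin_of_mem_nhds (hU.mem_nhds hqU), h0⟩

lemma ae_prod_mem {k : ℕ} {R : ℝ} {ν : Measure (EuclideanSpace ℝ (Fin (k + 1)))}
    {θ : Measure ℝ} (hν : ∀ᵐ q ∂ν, ‖q‖ ≤ R) (hθ : ∀ᵐ x ∂θ, x ∈ Icc (0 : ℝ) 1) :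
    ∀ᵐ z ∂(ν.prod θ), ‖z.1‖ ≤ R ∧ z.2 ∈ Icc (0 : ℝ) 1 :=
  (Measure.quasiMeasurePreserving_fst.ae hν).and (Measure.quasiMeasurePreserving_snd.ae hθ)

lemma ae_pact_mem {k : ℕ} {R : ℝ} {M : ℕ} (hM : (k + 1) * R < M)
    {ν : Measure (EuclideanSpace ℝ (Fin (k + 1)))} {θ : Measure ℝ}
    (hν : ∀ᵐ q ∂ν, ‖q‖ ≤ R) (hθ : ∀ᵐ x ∂θ, x ∈ Icc (0 : ℝ) 1) :
    ∀ᵐ y ∂(pact k ν θ), y ∈ Ico (-M : ℝ) M := by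
  refine (ae_map_iff (continuous_polyEval k).measurable.aemeasurable measurableSet_Ico).2 ?_
  filter_upwards [ae_prod_mem hν hθ] with z hz
  have := abs_le.1 (abs_polyEval_le hz.1 hz.2)
  exact ⟨by linarith [this.1], by linarith [this.2]⟩

instance isProbabilityMeasure_pact (k : ℕ) (ν : Measure (EuclideanSpace ℝ (Fin (k + 1))))
    (θ : Measure ℝ) [IsProbabilityMeasure ν] [IsProbabilityMeasure θ] :
    IsProbabilityMeasure (pact k ν θ) :=
  Measure.isProbabilityMeasure_map (continuous_polyEval k).measurable.aemeasurable

instance isFiniteMeasure_pact (k : ℕ) (ν : Measure (EuclideanSpace ℝ (Fin (k + 1))))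
    (θ : Measure ℝ) [IsFiniteMeasure ν] [IsFiniteMeasure θ] : IsFiniteMeasure (pact k ν θ) := by
  unfold pact
  infer_instance

/-- A product of components at level `n` acts with entropy `O(1)` at level `n`. -/
lemma ent1_pact_cond_le {k : ℕ} {R : ℝ} {L M : ℕ} (hL : (k + 1) * (1 + R * k) ≤ L)
    (hM : (k + 1) * R < M) (ν : Measure (EuclideanSpace ℝ (Fin (k + 1))))
    [IsFiniteMeasure ν] (θ : Measure ℝ) [IsFiniteMeasure θ]
    (hν : ∀ᵐ q ∂ν, ‖q‖ ≤ R) (hθ : ∀ᵐ x ∂θ, x ∈ Icc (0 : ℝ) 1) (n : ℕ) (u : Fin (k + 1) → ℤ)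
    (v : ℤ) (hu : ν (vcell (k + 1) n u) ≠ 0) (hv : θ (dyadIco n v) ≠ 0) :
    ent1 n (pact k (ProbabilityTheory.cond ν (vcell (k + 1) n u))
      (ProbabilityTheory.cond θ (dyadIco n v))) ≤ Real.logb 2 (2 * L + 3) := by
  have := ProbabilityTheory.cond_isProbabilityMeasure hu
  have := ProbabilityTheory.cond_isProbabilityMeasure hv
  have hcell : MeasurableSet (vcell (k + 1) n u) := by
    have : vcell (k + 1) n u = (fun q j => ⌊q j * 2 ^ n⌋) ⁻¹' {u} := by
      ext q
      exact mem_vcell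
    rw [this]
    exact measurable_floor_mul_apply n (measurableSet_singleton u)
  set ν' := ProbabilityTheory.cond ν (vcell (k + 1) n u)
  set θ' := ProbabilityTheory.cond θ (dyadIco n v)
  have hν' : ∀ᵐ q ∂ν', ‖q‖ ≤ R := ProbabilityTheory.cond_absolutelyContinuous.ae_le hν
  have hθ' : ∀ᵐ x ∂θ', x ∈ Icc (0 : ℝ) 1 := ProbabilityTheory.cond_absolutelyContinuous.ae_le hθ
  have hgood : ∀ᵐ z ∂(ν'.prod θ'), (‖z.1‖ ≤ R ∧ z.2 ∈ Icc (0 : ℝ) 1) ∧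
      z.1 ∈ vcell (k + 1) n u ∧ z.2 ∈ dyadIco n v :=
    (ae_prod_mem hν' hθ').and
      ((Measure.quasiMeasurePreserving_fst.ae (ProbabilityTheory.ae_cond_mem hcell)).and
        (Measure.quasiMeasurePreserving_snd.ae
          (ProbabilityTheory.ae_cond_mem (measurableSet_dyadIco n v))))
  obtain ⟨z₀, ⟨hz₀, hx₀⟩, hzu, hzv⟩ := hgood.exists
  refine ent1_le_logb_of_ae_near n L (ae_pact_mem hM hν' hθ') (polyEval k z₀.1 z₀.2) ?_
  rw [pact, ae_map_iff (continuous_polyEval k).measurable.aemeasurable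
    (measurableSet_le (by fun_prop) measurable_const)]
  filter_upwards [hgood] with z ⟨⟨_, hx⟩, hu', hv'⟩
  refine (abs_polyEval_sub_le hz₀ hx hx₀
    (fun j => abs_sub_le_of_mem_dyadIco (hu' j) (hzu j))
    (abs_sub_le_of_mem_dyadIco hv' hzv)).trans ?_
  rw [div_eq_mul_one_div (L : ℝ)]
  gcongr

/-- The average entropy of the components of `ν.θ` is controlled by an entropy increment. -/
lemma integral_ent1_components_le {k : ℕ} {R : ℝ} {L M : ℕ} (hR : 1 < R)
    (hL : (k + 1) * (1 + R * k) ≤ L)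
    (hM : (k + 1) * R < M) (ν : Measure (EuclideanSpace ℝ (Fin (k + 1))))
    [IsProbabilityMeasure ν] (θ : Measure ℝ) [IsProbabilityMeasure θ]
    (hν : ∀ᵐ q ∂ν, ‖q‖ ≤ R) (hθ : ∀ᵐ x ∂θ, x ∈ Icc (0 : ℝ) 1) (n m : ℕ) :
    ∫ z, ent1 (n + m) (pact k (vcomp ν z.1 n) (dcomp θ z.2 n)) ∂(ν.prod θ) ≤
      ent1 (n + m) (pact k ν θ) - ent1 n (pact k ν θ) + Real.logb 2 (2 * L + 3) := by
  have hRM : R < M := by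
    have : (0 : ℝ) ≤ k := k.cast_nonneg
    nlinarith
  set idx : EuclideanSpace ℝ (Fin (k + 1)) × ℝ → (Fin (k + 1) → ℤ) × ℤ :=
    fun z => (fun j => ⌊z.1 j * 2 ^ n⌋, ⌊z.2 * 2 ^ n⌋)
  have hidx_meas : Measurable idx :=
    ((measurable_floor_mul_apply n).comp measurable_fst).prodMk
      ((measurable_floor_mul n).comp measurable_snd)
  set F : Finset ((Fin (k + 1) → ℤ) × ℤ) :=
    Fintype.piFinset (fun _ => dyadIdx M n) ×ˢ dyadIdx M n
  set ρ := ν.prod θ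
  have hF : ∀ᵐ z ∂ρ, idx z ∈ F := by
    filter_upwards [ae_prod_mem hν hθ] with z hz
    refine Finset.mem_product.2 ⟨Fintype.mem_piFinset.2 fun j => floor_mem_dyadIdx n ?_,
      floor_mem_dyadIdx n ⟨?_, ?_⟩⟩
    · have := abs_le.1 ((abs_apply_le_norm z.1 j).trans hz.1)
      exact ⟨by linarith [this.1], by linarith [this.2]⟩
    · linarith [hz.2.1]
    · linarith [hz.2.2]
  set μc : (Fin (k + 1) → ℤ) × ℤ → Measure ℝ := fun c =>
    pact k (ProbabilityTheory.cond ν (vcell (k + 1) n c.1))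
      (ProbabilityTheory.cond θ (dyadIco n c.2))
  set p : (Fin (k + 1) → ℤ) × ℤ → ℝ := fun c => ρ.real (idx ⁻¹' {c}) with hp
  have hcell : ∀ c, idx ⁻¹' {c} = vcell (k + 1) n c.1 ×ˢ dyadIco n c.2 := by
    intro c
    ext z
    rw [mem_prod, mem_vcell, mem_dyadIco, mem_preimage, mem_singleton_iff, Prod.ext_iff]
  have hpc : ∀ c, ρ (idx ⁻¹' {c}) = ν (vcell (k + 1) n c.1) * θ (dyadIco n c.2) := fun c => by
    rw [hcell, Measure.prod_prod]
  have hint : ∫ z, ent1 (n + m) (pact k (vcomp ν z.1 n) (dcomp θ z.2 n)) ∂ρ =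
      ∑ c ∈ F, p c * ent1 (n + m) (μc c) := by
    have hcongr : (fun z => ent1 (n + m) (pact k (vcomp ν z.1 n) (dcomp θ z.2 n))) =ᵐ[ρ]
        fun z => ∑ c ∈ F, (idx ⁻¹' {c}).indicator (fun _ => ent1 (n + m) (μc c)) z := by
      filter_upwards [hF] with z hz
      rw [Finset.sum_eq_single (idx z)]
      · rw [indicator_of_mem (show z ∈ idx ⁻¹' {idx z} from rfl)]
        rfl
      · intro c _ hc
        exact indicator_of_notMem (s := idx ⁻¹' {c}) (fun h => hc (Eq.symm h)) _
      · exact fun h => absurd hz h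
    rw [integral_congr_ae hcongr, integral_finsetSum]
    · refine Finset.sum_congr rfl fun c _ => ?_
      rw [integral_indicator_const _ (hidx_meas (measurableSet_singleton c)), smul_eq_mul]
    · exact fun c _ => (integrable_const _).indicator (hidx_meas (measurableSet_singleton c))
  have hmix : ∀ l J, (pact k ν θ).real (dyadIco l J) =
      ∑ c ∈ F, p c * (μc c).real (dyadIco l J) := by
    intro l J
    have hΦ := (continuous_polyEval k).measurable
    rw [pact, map_measureReal_apply hΦ (measurableSet_dyadIco l J),
      measureReal_eq_sum_inter_preimage _ hidx_meas hF]
    refine Finset.sum_congr rfl fun c _ => ?_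
    change _ = p c * (Measure.map _ _).real _
    rw [map_measureReal_apply hΦ (measurableSet_dyadIco l J),
      ← measureReal_restrict_apply (hΦ (measurableSet_dyadIco l J))]
    have hres : ρ.restrict (idx ⁻¹' {c}) = ρ (idx ⁻¹' {c}) •
        (ProbabilityTheory.cond ν (vcell (k + 1) n c.1)).prod
          (ProbabilityTheory.cond θ (dyadIco n c.2)) := by
      rw [hpc, hcell, ← Measure.prod_restrict, restrict_eq_smul_cond ν, restrict_eq_smul_cond θ,
        Measure.prod_smul_right, Measure.prod_smul_left, smul_smul, mul_comm]
    rw [hres, measureReal_ennreal_smul_apply]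
    rfl
  have hsum : ∑ c ∈ F, p c = 1 := by
    have := measureReal_eq_sum_inter_preimage ρ hidx_meas hF univ
    simpa using this.symm
  have hbound : ∀ c, p c * ent1 n (μc c) ≤ p c * Real.logb 2 (2 * L + 3) := by
    intro c
    by_cases h0 : ρ (idx ⁻¹' {c}) = 0
    · simp [hp, Measure.real, h0]
    · rw [hpc, mul_eq_zero, not_or] at h0
      exact mul_le_mul_of_nonneg_left
        (ent1_pact_cond_le hL hM ν θ hν hθ n c.1 c.2 h0.1 h0.2) measureReal_nonneg
  have hconc := sum_mul_ent1_sub_le F p (fun c => measureReal_nonneg) (pact k ν θ) μc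
    (ae_pact_mem hM hν hθ) (fun c => ae_pact_mem hM
      (ProbabilityTheory.cond_absolutelyContinuous.ae_le hν)
      (ProbabilityTheory.cond_absolutelyContinuous.ae_le hθ)) n m hmix
  have htot := Finset.sum_le_sum fun c (_ : c ∈ F) => hbound c
  rw [← Finset.sum_mul, hsum, one_mul] at htot
  simp only [mul_sub, Finset.sum_sub_distrib] at hconc
  rw [hint]
  linarith

/-- A telescoping bound for increments over `m` steps of a sequence growing at unit rate. -/
lemma sum_add_sub_le {h : ℕ → ℝ} (h0 : ∀ i, 0 ≤ h i) (hadd : ∀ i j, h (i + j) ≤ h i + j)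
    (n m : ℕ) : ∑ i ∈ Finset.Icc 1 n, (h (i + m) - h i) ≤ m * (h n + m) := by
  have hstep : ∀ l, ∑ i ∈ Finset.Icc 1 n, (h (i + (l + 1)) - h (i + l)) ≤ h n + (l + 1 : ℕ) := by
    intro l
    have htel : ∑ i ∈ Finset.Icc 1 n, (h (i + (l + 1)) - h (i + l)) =
        h (n + (l + 1)) - h (l + 1) := by
      rw [← Finset.Ico_add_one_right_eq_Icc, Finset.sum_Ico_eq_sum_range]
      have := Finset.sum_range_sub (fun i => h (1 + i + l)) n
      simp only [Nat.add_sub_cancel]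
      rw [show n + (l + 1) = 1 + n + l by omega, show l + 1 = 1 + 0 + l by omega, ← this]
      refine Finset.sum_congr rfl fun i _ => ?_
      rw [show 1 + i + (1 + 0 + l) = 1 + (i + 1) + l by omega]
    rw [htel]
    linarith [h0 (l + 1), hadd n (l + 1)]
  have hsplit : ∀ i, h (i + m) - h i = ∑ l ∈ Finset.range m, (h (i + (l + 1)) - h (i + l)) :=
    fun i => (Finset.sum_range_sub (fun l => h (i + l)) m).symm
  simp only [hsplit]
  rw [Finset.sum_comm]
  calc _ ≤ ∑ l ∈ Finset.range m, (h n + m) := by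
        refine Finset.sum_le_sum fun l hl => (hstep l).trans ?_
        gcongr
        exact Finset.mem_range.1 hl
    _ = m * (h n + m) := by rw [Finset.sum_const, Finset.card_range, nsmul_eq_mul]

theorem entropy_via_components
    (k : ℕ) (hk : 1 ≤ k) (R : ℝ) (hR : 1 < R) :
    ∃ K : ℝ, 0 < K ∧
      ∀ ν : Measure (EuclideanSpace ℝ (Fin (k + 1))), IsProbabilityMeasure ν →
        (∃ S : Set (EuclideanSpace ℝ (Fin (k + 1))), IsCompact S ∧ ν Sᶜ = 0) →
        (∀ q ∈ msupp ν, ‖q‖ ≤ R) →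
        ∀ θ : Measure ℝ, IsProbabilityMeasure θ → θ unitIᶜ = 0 →
          ∀ n m : ℕ, 1 ≤ m → m ≤ n →
            (1 / (n : ℝ)) * ∑ i ∈ Finset.Icc 1 n,
                (∫ qx : EuclideanSpace ℝ (Fin (k + 1)) × ℝ,
                  (1 / (m : ℝ)) * ent1 (i + m) (pact k (vcomp ν qx.1 i) (dcomp θ qx.2 i))
                  ∂(ν.prod θ)) - K * (1 / (m : ℝ) + (m : ℝ) / (n : ℝ)) ≤
              (1 / (n : ℝ)) * ent1 n (pact k ν θ) := by
  obtain ⟨L, hL⟩ := exists_nat_ge ((k + 1 : ℝ) * (1 + R * k))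
  obtain ⟨M, hM⟩ := exists_nat_gt ((k + 1 : ℝ) * R)
  have hC : 0 ≤ Real.logb 2 (2 * L + 3) :=
    Real.logb_nonneg one_lt_two (by linarith [(L.cast_nonneg : (0 : ℝ) ≤ L)])
  refine ⟨1 + Real.logb 2 (2 * L + 3), by positivity, ?_⟩
  intro ν _ _ hsupp θ _ hI n m hm hmn
  have hν := ae_norm_le_of_msupp hsupp
  have hθ : ∀ᵐ x ∂θ, x ∈ Icc (0 : ℝ) 1 := hI
  have hm0 : (0 : ℝ) < m := by exact_mod_cast hm
  have hn0 : (0 : ℝ) < n := by exact_mod_cast hm.trans hmn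
  set C := Real.logb 2 (2 * L + 3)
  set h : ℕ → ℝ := fun i => ent1 i (pact k ν θ)
  have htel := sum_add_sub_le (h := h) (fun i => ent1_nonneg i _)
    (fun i j => ent1_add_le i j (ae_pact_mem hM hν hθ)) n m
  have hsum : ∑ i ∈ Finset.Icc 1 n, (∫ qx : EuclideanSpace ℝ (Fin (k + 1)) × ℝ,
      (1 / (m : ℝ)) * ent1 (i + m) (pact k (vcomp ν qx.1 i) (dcomp θ qx.2 i)) ∂(ν.prod θ)) ≤
      h n + m + n * C / m := by
    simp only [integral_const_mul]
    rw [← Finset.mul_sum, one_div_mul_eq_div, div_le_iff₀ hm0, add_mul, div_mul_cancel₀ _ hm0.ne']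
    refine (Finset.sum_le_sum fun i _ =>
      integral_ent1_components_le hR hL hM ν θ hν hθ i m).trans ?_
    rw [Finset.sum_add_distrib, Finset.sum_const, Nat.card_Icc, Nat.add_sub_cancel, nsmul_eq_mul]
    change ∑ i ∈ Finset.Icc 1 n, (h (i + m) - h i) + n * C ≤ _
    linarith
  have hscaled := mul_le_mul_of_nonneg_left hsum (one_div_nonneg.2 hn0.le)
  have hexp : 1 / (n : ℝ) * (h n + m + n * C / m) = 1 / n * h n + m / n + C / m := by
    field_simp
  have h1 : (0 : ℝ) ≤ 1 / m := by positivity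
  have h2 : 0 ≤ C * (m / n) := by positivity
  rw [hexp] at hscaled
  have hK : (m : ℝ) / n + C / m ≤ (1 + C) * (1 / m + m / n) := by
    rw [div_eq_mul_one_div C]
    nlinarith
  change _ ≤ 1 / (n : ℝ) * h n
  linarith
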